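/- Let τ ∈ ℂ with Im τ > 0, q := e^{2πiτ}. Let u, v ∈ ℂ∖(ℤ+ℤτ) and α ∈ ℂ with Im(ατ) > 0 (so that |a| < 1 where a := q^α). Set x := e^{2πiu}, y := e^{2πiv}, and assume x, y, x/a, y/a ∉ q^ℤ := {q^m : m ∈ ℤ}. Then the generalized Zwegers μ-function has the three bilateral basic hypergeometric expressions: μ(x,y;a) = −i q^{−1/8} (x/y)^{α/2} · (1/((q;q)_∞ θ(x/a))) · ((aq/y;q)_∞/(q/y;q)_∞) · ₁ψ₂(y/a; 0, y; q, x) = −i q^{−1/8} (x/y)^{α/2} · ((a, aq/x, aq/y;q)_∞ / ((q;q)_∞ θ(y) θ(x/a))) · ₂ψ₂(x/a, y/a; 0, 0; q, a) = −i q^{−1/8} (x/y)^{α/2} · ((a, x, y;q)_∞ / ((q;q)_∞ θ(y) θ(x/a))) · ₀ψ₂(— ; x, y; q, xy/a). -/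

import Mathlib

noncomputable section

/-- `e z = exp(2πiz)`. -/
def e (z : ℂ) : ℂ := Complex.exp (2 * (Real.pi : ℂ) * Complex.I * z)

/-- Infinite q-Pochhammer symbol `(a;q)_∞`. -/
def qpinf (a q : ℂ) : ℂ := ∏' j : ℕ, (1 - a * q ^ j)

/-- `(a;q)_n` for `n : ℤ`, defined as `(a;q)_∞ / (a q^n;q)_∞`. -/
def qpint (a q : ℂ) (n : ℤ) : ℂ := qpinf a q / qpinf (a * q ^ n) q

/-- `θ(x) = (x;q)_∞ (q/x;q)_∞`. -/
def qtheta (q x : ℂ) : ℂ := qpinf x q * qpinf (q / x) q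

/-- Jacobi theta `ϑ₁₁(v) = -i q^{1/8} e^{-πiv} (q;q)_∞ θ(e^{2πiv})`. -/
def theta11 (τ v : ℂ) : ℂ :=
  -Complex.I * e (τ / 8) * e (-v / 2) * qpinf (e τ) (e τ) * qtheta (e τ) (e v)

/-- Generalized Zwegers μ-function `μ(u,v;α)`. -/
def genMu (τ u v α : ℂ) : ℂ :=
  e (α * (u - v) / 2) / theta11 τ v *
    ∑' n : ℤ, (-1 : ℂ) ^ n * e (((n : ℂ) + 1 / 2) * v) * (e τ) ^ ((n * (n + 1)) / 2) *
      (qpinf (e u * (e τ) ^ (n + 1)) (e τ) /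
       qpinf (e u * e (τ * ((n : ℂ) - α + 1))) (e τ))

open Filter Topology

lemma summable_qpinf_factors {q : ℂ} (hq : ‖q‖ < 1) (A : ℂ) :
    Summable fun j : ℕ => ‖-(A * q ^ j)‖ := by
  simp only [norm_neg, norm_mul, norm_pow]
  exact (summable_geometric_of_lt_one (norm_nonneg _) hq).mul_left _

lemma tendsto_qpinf {q : ℂ} (hq : ‖q‖ < 1) (A : ℂ) :
    Tendsto (fun n : ℕ => ∏ j ∈ Finset.range n, (1 - A * q ^ j)) atTop (𝓝 (qpinf A q)) := by
  have h := (multipliable_one_add_of_summable (summable_qpinf_factors hq A)).hasProd.tendsto_prod_nat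
  simpa only [qpinf, sub_eq_add_neg] using h

lemma qpinf_succ {q : ℂ} (hq : ‖q‖ < 1) (A : ℂ) :
    qpinf A q = (1 - A) * qpinf (A * q) q := by
  have h1 := (tendsto_add_atTop_iff_nat 1).2 (tendsto_qpinf hq A)
  have h2 := (tendsto_qpinf hq (A * q)).const_mul (1 - A)
  refine tendsto_nhds_unique h1 (h2.congr fun n => ?_)
  rw [Finset.prod_range_succ']
  simp only [pow_zero, mul_one, pow_succ']
  rw [mul_comm]
  simp only [mul_assoc]

lemma qpinf_zero (q : ℂ) : qpinf 0 q = 1 := by simp [qpinf]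

lemma qpinf_ne_zero {q : ℂ} (hq : ‖q‖ < 1) {A : ℂ} (hA : ∀ j : ℕ, A * q ^ j ≠ 1) :
    qpinf A q ≠ 0 := by
  have h := tprod_one_add_ne_zero_of_summable (f := fun j : ℕ => -(A * q ^ j))
    (fun j h => hA j (by linear_combination -h)) (summable_qpinf_factors hq A)
  simpa only [qpinf, sub_eq_add_neg] using h

lemma one_sub_pow_succ_ne_zero {q : ℂ} (hq : ‖q‖ < 1) (j : ℕ) : 1 - q ^ (j + 1) ≠ 0 := by
  intro h
  have h' := pow_lt_one₀ (norm_nonneg q) hq j.succ_ne_zero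
  rw [← norm_pow, Nat.succ_eq_add_one, ← sub_eq_zero.1 h] at h'
  simp at h'

lemma qpinf_self_ne_zero {q : ℂ} (hq : ‖q‖ < 1) : qpinf q q ≠ 0 :=
  qpinf_ne_zero hq fun j h => one_sub_pow_succ_ne_zero hq j (by rw [pow_succ', h, sub_self])

lemma qpinf_zpow_ne_zero {q A : ℂ} (hq : ‖q‖ < 1) (h0 : q ≠ 0) (hA : ∀ m : ℤ, A ≠ q ^ m) (n : ℤ) :
    qpinf (A * q ^ n) q ≠ 0 := by
  refine qpinf_ne_zero hq fun j h => hA (-(n + j)) ?_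
  rw [zpow_neg, zpow_add₀ h0, zpow_natCast]
  exact eq_inv_of_mul_eq_one_left (by rw [← mul_assoc]; exact h)

lemma qpinf_zpow_succ {q : ℂ} (hq : ‖q‖ < 1) (h0 : q ≠ 0) (A : ℂ) (n : ℤ) :
    qpinf (A * q ^ n) q = (1 - A * q ^ n) * qpinf (A * q ^ (n + 1)) q := by
  rw [qpinf_succ hq, zpow_add_one₀ h0, mul_assoc A]

lemma qpinf_eq_zero_of_neg {q : ℂ} (hq : ‖q‖ < 1) (h0 : q ≠ 0) (k : ℕ) :
    qpinf (q ^ (-(k : ℤ))) q = 0 := by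
  induction k with
  | zero => rw [qpinf_succ hq]; simp
  | succ k ih =>
    have h := qpinf_zpow_succ hq h0 1 (-((k + 1 : ℕ) : ℤ))
    rw [one_mul, one_mul] at h
    rw [h]
    have : (-((k + 1 : ℕ) : ℤ)) + 1 = -(k : ℤ) := by push_cast; ring
    rw [this, ih, mul_zero]

/-- The power series with coefficient recursion of `q`-binomial type. -/
lemma tsum_mul_qpinf {q : ℂ} (hq : ‖q‖ < 1) {A B z : ℂ} (hz : ‖B * z‖ < 1) {c : ℕ → ℂ}
    (hc0 : c 0 = 1) (hc : ∀ k, c (k + 1) * (1 - q ^ (k + 1)) = c k * (B - A * q ^ k)) :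
    (∑' k, c k * z ^ k) * qpinf (B * z) q = qpinf (A * z) q := by
  have hqt : Tendsto (fun k : ℕ => q ^ k) atTop (𝓝 0) := tendsto_pow_atTop_nhds_zero_of_norm_lt_one hq
  have hqt1 : Tendsto (fun k : ℕ => q ^ (k + 1)) atTop (𝓝 0) := (tendsto_add_atTop_iff_nat 1).2 hqt
  have hrec : ∀ k, c (k + 1) = (B - A * q ^ k) / (1 - q ^ (k + 1)) * c k := fun k => by
    rw [div_mul_eq_mul_div, eq_div_iff (one_sub_pow_succ_ne_zero hq k), hc, mul_comm]
  have hrat : Tendsto (fun k : ℕ => ‖(B - A * q ^ k) / (1 - q ^ (k + 1)) * z‖) atTop (𝓝 ‖B * z‖) := by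
    have := ((((hqt.const_mul A).const_sub B).div (hqt1.const_sub 1) (by simp)).mul_const z).norm
    simpa using this
  have hs : Summable fun k => c k * z ^ k := by
    obtain ⟨r, hr1, hr2⟩ := exists_between hz
    refine summable_of_ratio_norm_eventually_le (r := r) hr2 ?_
    filter_upwards [hrat.eventually_le_const hr1] with k hk
    rw [hrec, pow_succ z, show ∀ a b c d : ℂ, a * b * (c * d) = (a * d) * (b * c) by intros; ring,
      norm_mul]
    gcongr
  have hw : ∀ w : ℂ, ‖w‖ ≤ 1 → Summable fun k => c k * (w * z) ^ k := fun w hw1 => by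
    refine Summable.of_norm_bounded hs.norm fun k => ?_
    rw [mul_pow, norm_mul, norm_mul, norm_mul, norm_pow]
    have : ‖w‖ ^ k ≤ 1 := pow_le_one₀ (norm_nonneg _) hw1
    gcongr
    exact mul_le_of_le_one_left (norm_nonneg _) this
  set F : ℂ → ℂ := fun w => ∑' k, c k * (w * z) ^ k with hF
  have hfun : ∀ w : ℂ, ‖w‖ ≤ 1 → (1 - B * z * w) * F w = (1 - A * z * w) * F (w * q) := by
    intro w hw1
    have hwq : ‖w * q‖ ≤ 1 := by rw [norm_mul]; exact mul_le_one₀ hw1 (norm_nonneg _) hq.le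
    have s1 := hw w hw1
    have s2 := hw _ hwq
    have e1 : F w - F (w * q) = ∑' k, (c k * (w * z) ^ k - c k * (w * q * z) ^ k) :=
      (s1.tsum_sub s2).symm
    rw [(s1.sub s2).tsum_eq_zero_add] at e1
    have e2 : B * z * w * F w - A * z * w * F (w * q) =
        ∑' k, (B * z * w * (c k * (w * z) ^ k) - A * z * w * (c k * (w * q * z) ^ k)) := by
      rw [(s1.mul_left _).tsum_sub (s2.mul_left _), tsum_mul_left, tsum_mul_left]
    have e3 : F w - F (w * q) = B * z * w * F w - A * z * w * F (w * q) := by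
      rw [e1, e2]
      simp only [pow_zero, sub_self, zero_add]
      refine tsum_congr fun k => ?_
      simp only [mul_pow]
      linear_combination (w * z) ^ (k + 1) * hc k
    linear_combination e3
  have hpow : ∀ N : ℕ, ‖q ^ N‖ ≤ 1 := fun N => by
    rw [norm_pow]; exact pow_le_one₀ (norm_nonneg _) hq.le
  have hiter : ∀ N : ℕ, F 1 * ∏ j ∈ Finset.range N, (1 - B * z * q ^ j) =
      (∏ j ∈ Finset.range N, (1 - A * z * q ^ j)) * F (q ^ N) := by
    intro N
    induction N with
    | zero => simp
    | succ N ih =>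
      rw [Finset.prod_range_succ, Finset.prod_range_succ, pow_succ, ← mul_assoc, ih]
      linear_combination (∏ j ∈ Finset.range N, (1 - A * z * q ^ j)) * hfun _ (hpow N)
  have hlim : Tendsto (fun N : ℕ => F (q ^ N)) atTop (𝓝 1) := by
    have : (1 : ℂ) = ∑' k : ℕ, if k = 0 then 1 else 0 := by rw [tsum_ite_eq]
    rw [this]
    refine tendsto_tsum_of_dominated_convergence hs.norm (fun k => ?_)
      (Eventually.of_forall fun N k => ?_)
    · rcases Nat.eq_zero_or_pos k with rfl | hk
      · simp [hc0]
      · rw [if_neg hk.ne']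
        have := (((hqt.mul_const z).pow k).const_mul (c k))
        simpa [hk.ne'] using this
    · rw [mul_pow, norm_mul, norm_mul, norm_mul]
      gcongr
      refine mul_le_of_le_one_left (norm_nonneg _) ?_
      rw [norm_pow]
      exact pow_le_one₀ (norm_nonneg _) (hpow N)
  have l1 := (tendsto_qpinf hq (B * z)).const_mul (F 1)
  have l2 := (tendsto_qpinf hq (A * z)).mul hlim
  have := tendsto_nhds_unique (l1.congr hiter) l2
  simpa [hF] using this

/-- `1 / (q;q)_k`, extended by zero to negative `k`. -/
def qpinv (q : ℂ) (k : ℤ) : ℂ := qpinf (q ^ (k + 1)) q / qpinf q q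

lemma qpinv_neg {q : ℂ} (hq : ‖q‖ < 1) (h0 : q ≠ 0) {k : ℤ} (hk : k < 0) : qpinv q k = 0 := by
  obtain ⟨j, hj⟩ := Int.eq_ofNat_of_zero_le (show 0 ≤ -(k + 1) by omega)
  rw [qpinv, show k + 1 = -(j : ℤ) by omega, qpinf_eq_zero_of_neg hq h0, zero_div]

lemma qpinv_zero {q : ℂ} (hq : ‖q‖ < 1) : qpinv q 0 = 1 := by
  simp [qpinv, qpinf_self_ne_zero hq]

lemma qpinv_succ {q : ℂ} (hq : ‖q‖ < 1) (h0 : q ≠ 0) (k : ℕ) :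
    qpinv q ((k + 1 : ℕ) : ℤ) * (1 - q ^ (k + 1)) = qpinv q k := by
  have h := qpinf_zpow_succ hq h0 1 (k + 1)
  rw [one_mul, one_mul] at h
  rw [qpinv, qpinv, h]
  push_cast
  rw [show q ^ (k + 1) = q ^ ((k : ℤ) + 1) by exact_mod_cast (zpow_natCast q (k + 1)).symm]
  ring

lemma qpinv_bounded {q : ℂ} (hq : ‖q‖ < 1) (h0 : q ≠ 0) : ∃ C, ∀ k : ℤ, ‖qpinv q k‖ ≤ C := by
  have hprod : ∀ k : ℕ, qpinv q k = (∏ j ∈ Finset.range k, (1 - q * q ^ j))⁻¹ := by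
    intro k
    induction k with
    | zero => simp [qpinv_zero hq]
    | succ k ih =>
      rw [Finset.prod_range_succ, mul_inv, ← ih, ← qpinv_succ hq h0 k, ← pow_succ', mul_assoc,
        mul_inv_cancel₀ (one_sub_pow_succ_ne_zero hq k), mul_one]
  have ht : Tendsto (fun k : ℕ => ‖qpinv q k‖) atTop (𝓝 ‖(qpinf q q)⁻¹‖) := by
    simp only [hprod]
    exact ((tendsto_qpinf hq q).inv₀ (qpinf_self_ne_zero hq)).norm
  obtain ⟨C, hC⟩ := ht.bddAbove_range
  refine ⟨C, fun k => ?_⟩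
  rcases lt_or_ge k 0 with hk | hk
  · rw [qpinv_neg hq h0 hk, norm_zero]
    exact (norm_nonneg _).trans (hC ⟨0, rfl⟩)
  · lift k to ℕ using hk
    exact hC ⟨k, rfl⟩

lemma tsum_int_mul_qpinv {q : ℂ} (hq : ‖q‖ < 1) (h0 : q ≠ 0) (f : ℤ → ℂ) :
    ∑' k : ℤ, f k * qpinv q k = ∑' k : ℕ, f k * qpinv q k := by
  refine (Function.Injective.tsum_eq Nat.cast_injective fun k hk => ?_).symm
  have : 0 ≤ k := by
    by_contra h
    exact hk (by simp only [qpinv_neg hq h0 (not_le.1 h), mul_zero])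
  exact ⟨k.toNat, Int.toNat_of_nonneg this⟩

/-- The theta coefficient `(-1)^n q^{n(n-1)/2}`. -/
def qtri (q : ℂ) (n : ℤ) : ℂ := (-1 : ℂ) ^ n * q ^ ((n * (n - 1)) / 2)

lemma qtri_zero (q : ℂ) : qtri q 0 = 1 := by simp [qtri]

lemma qtri_succ {q : ℂ} (h0 : q ≠ 0) (n : ℤ) : qtri q (n + 1) = -q ^ n * qtri q n := by
  have h : (n + 1) * (n + 1 - 1) / 2 = n * (n - 1) / 2 + n := by
    rw [show (n + 1) * (n + 1 - 1) = n * (n - 1) + n * 2 by ring,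
      Int.add_mul_ediv_right _ _ (by norm_num)]
  rw [qtri, qtri, h, zpow_add₀ h0, zpow_add_one₀ (by norm_num)]
  ring

lemma qtri_ne_zero {q : ℂ} (h0 : q ≠ 0) (n : ℤ) : qtri q n ≠ 0 :=
  mul_ne_zero (zpow_ne_zero _ (by norm_num)) (zpow_ne_zero _ h0)

lemma eq_of_int_recursion {f g r : ℤ → ℂ} (hr : ∀ n, r n ≠ 0) (h0 : f 0 = g 0)
    (hf : ∀ n, f (n + 1) = r n * f n) (hg : ∀ n, g (n + 1) = r n * g n) (n : ℤ) : f n = g n := by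
  induction n using Int.induction_on with
  | zero => exact h0
  | succ n ih => rw [hf, hg, ih]
  | pred n ih =>
    have h1 := hf (-(n : ℤ) - 1)
    have h2 := hg (-(n : ℤ) - 1)
    rw [sub_add_cancel] at h1 h2
    exact mul_left_cancel₀ (hr _) (h1.symm.trans (ih.trans h2))

lemma qtri_neg {q : ℂ} (h0 : q ≠ 0) (n : ℤ) : qtri q (-n) = qtri q n * q ^ n := by
  refine eq_of_int_recursion (f := fun n => qtri q (-n)) (g := fun n => qtri q n * q ^ n)
    (r := fun n => -q ^ (n + 1)) (fun n => neg_ne_zero.2 (zpow_ne_zero _ h0)) (by simp) (fun n => ?_)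
    (fun n => ?_) n
  · have h := qtri_succ h0 (-(n + 1))
    rw [show -(n + 1) + 1 = -n by ring] at h
    rw [h, zpow_neg]
    field_simp [zpow_ne_zero (n + 1) h0]
  · rw [qtri_succ h0, zpow_add_one₀ h0]
    ring

lemma qtri_sub {q : ℂ} (h0 : q ≠ 0) (n k : ℤ) :
    qtri q (n - k) = qtri q n * qtri q k * (q / q ^ n) ^ k := by
  have hn := zpow_ne_zero n h0
  refine eq_of_int_recursion (f := fun k => qtri q (n - k))
    (g := fun k => qtri q n * qtri q k * (q / q ^ n) ^ k)
    (r := fun k => -q ^ k * (q / q ^ n))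
    (fun k => mul_ne_zero (neg_ne_zero.2 (zpow_ne_zero _ h0)) (div_ne_zero h0 hn))
    (by simp [qtri_zero]) (fun k => ?_) (fun k => ?_) k
  · have h := qtri_succ h0 (n - (k + 1))
    rw [show n - (k + 1) + 1 = n - k by ring] at h
    rw [h, zpow_sub₀ h0, zpow_add_one₀ h0]
    have hk := zpow_ne_zero k h0
    field_simp
  · rw [qtri_succ h0, zpow_add_one₀ (div_ne_zero h0 hn)]
    ring

lemma qtheta_zpow {q X : ℂ} (hq : ‖q‖ < 1) (h0 : q ≠ 0) (hX : X ≠ 0) (n : ℤ) :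
    qtri q n * X ^ n * (qpinf (X * q ^ n) q * qpinf (q / X * q ^ (-n)) q) = qtheta q X := by
  have hstep : ∀ z : ℂ, z ≠ 0 →
      -z * (qpinf (z * q) q * qpinf z⁻¹ q) = qpinf z q * qpinf (q / z) q := fun z hz => by
    rw [qpinf_succ hq z, qpinf_succ hq z⁻¹, show z⁻¹ * q = q / z by ring]
    field_simp
    ring
  refine eq_of_int_recursion (r := fun _ => 1)
    (f := fun n => qtri q n * X ^ n * (qpinf (X * q ^ n) q * qpinf (q / X * q ^ (-n)) q))
    (g := fun _ => qtheta q X) (fun _ => one_ne_zero)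
    (by simp [qtri_zero, qtheta]) (fun n => ?_) (fun n => by simp) n
  have hn := zpow_ne_zero n h0
  have h := hstep (X * q ^ n) (mul_ne_zero hX hn)
  rw [qtri_succ h0, zpow_add_one₀ hX,
    show X * q ^ (n + 1) = X * q ^ n * q by rw [zpow_add_one₀ h0, mul_assoc],
    show q / X * q ^ (-(n + 1)) = (X * q ^ n)⁻¹ by rw [zpow_neg, zpow_add_one₀ h0]; field_simp,
    show q / X * q ^ (-n) = q / (X * q ^ n) by rw [zpow_neg]; field_simp, one_mul, ← h]
  ring

lemma qtheta_ne_zero {q X : ℂ} (hq : ‖q‖ < 1) (h0 : q ≠ 0) (hX : X ≠ 0) (hX' : ∀ m : ℤ, X ≠ q ^ m) :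
    qtheta q X ≠ 0 := by
  refine mul_ne_zero ?_ ?_
  · simpa using qpinf_zpow_ne_zero hq h0 hX' 0
  · have := qpinf_zpow_ne_zero hq h0 (A := q / X) (fun m h => hX' (1 - m) ?_) 0
    · simpa using this
    · rw [zpow_sub₀ h0, ← h, zpow_one]
      field_simp

lemma tsum_qtri_mul_pow {q : ℂ} (hq : ‖q‖ < 1) (h0 : q ≠ 0) (z : ℂ) :
    ∑' k : ℤ, qtri q k * z ^ k * qpinv q k = qpinf z q := by
  rw [tsum_int_mul_qpinv hq h0 fun k => qtri q k * z ^ k]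
  have h := tsum_mul_qpinf hq (A := 1) (B := 0) (z := z) (by simp)
    (c := fun k => qtri q k * qpinv q k) (by simp [qtri_zero, qpinv_zero hq]) (fun k => by
      rw [mul_assoc, qpinv_succ hq h0]
      push_cast
      rw [qtri_succ h0, zpow_natCast]
      ring)
  rw [zero_mul, qpinf_zero, one_mul, mul_one] at h
  rw [← h]
  exact tsum_congr fun k => by rw [zpow_natCast]; ring

lemma tsum_qtri_mul_qpinv_sub {q Y : ℂ} (hq : ‖q‖ < 1) (h0 : q ≠ 0) (hY : Y ≠ 0) (n : ℤ) :
    ∑' m : ℤ, qtri q m * Y ^ m * qpinv q (n - m) =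
      qtri q n * Y ^ n * qpinf (q / Y * q ^ (-n)) q := by
  rw [← tsum_qtri_mul_pow hq h0, ← tsum_mul_left, ← (Equiv.subLeft n).tsum_eq]
  refine tsum_congr fun k => ?_
  simp only [Equiv.subLeft_apply, sub_sub_cancel]
  rw [qtri_sub h0, zpow_sub₀ hY, zpow_neg, show q / Y * (q ^ n)⁻¹ = q / q ^ n / Y by ring, div_zpow _ Y]
  ring

lemma tsum_pow_mul_qpinv_sub {q a X : ℂ} (hq : ‖q‖ < 1) (h0 : q ≠ 0) (ha0 : a ≠ 0) (ha : ‖a‖ < 1)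
    (hX : ∀ m : ℤ, X ≠ q ^ m) (m : ℤ) :
    (∑' n : ℤ, a ^ n / qpinf (X * q ^ n) q * qpinv q (n - m)) * qpinf a q =
      a ^ m * qpinf (a * X * q ^ m) q / qpinf (X * q ^ m) q := by
  have hne := qpinf_zpow_ne_zero hq h0 hX
  have h := tsum_mul_qpinf hq (A := X * q ^ m) (B := 1) (z := a) (by simpa using ha)
    (c := fun k => qpinf (X * q ^ m) q / qpinf (X * q ^ (m + k)) q * qpinv q k)
    (by simp [qpinv_zero hq, hne]) (fun k => by
      rw [mul_assoc, qpinv_succ hq h0, qpinf_zpow_succ hq h0 X (m + k), zpow_add₀ h0 m k, zpow_natCast]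
      have h1 := hne (m + k)
      have h2 := hne (m + (k + 1))
      rw [qpinf_zpow_succ hq h0 X (m + k), zpow_add₀ h0 m k, zpow_natCast] at h1
      have h3 := left_ne_zero_of_mul h1
      push_cast
      rw [← add_assoc] at h2 ⊢
      rw [show 1 - X * q ^ m * q ^ k = 1 - X * (q ^ m * q ^ k) by ring]
      generalize 1 - X * (q ^ m * q ^ k) = D at *
      field_simp)
  rw [← (Equiv.addLeft m).tsum_eq]
  simp only [Equiv.coe_addLeft, add_sub_cancel_left]
  rw [tsum_int_mul_qpinv hq h0 fun k => a ^ (m + k) / qpinf (X * q ^ (m + k)) q]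
  rw [one_mul] at h
  rw [show a * X * q ^ m = X * q ^ m * a by ring, ← h, ← mul_assoc, ← tsum_mul_left, mul_div_right_comm,
    ← tsum_div_const]
  congr 1
  refine tsum_congr fun k => ?_
  have := hne m
  rw [zpow_add₀ ha0, zpow_natCast]
  field_simp

lemma summable_of_ratio_tendsto {f r : ℕ → ℂ} {L : ℂ} (hL : ‖L‖ < 1) (hr : Tendsto r atTop (𝓝 L))
    (h : ∀ n, f (n + 1) = r n * f n) : Summable f := by
  obtain ⟨s, hs1, hs2⟩ := exists_between hL
  refine summable_of_ratio_norm_eventually_le (r := s) hs2 ?_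
  filter_upwards [hr.norm.eventually_le_const hs1] with n hn
  rw [h, norm_mul]
  gcongr

lemma summable_qtri {q Y : ℂ} (hq : ‖q‖ < 1) (h0 : q ≠ 0) (hY : Y ≠ 0) :
    Summable fun n : ℤ => qtri q n * Y ^ n := by
  have hqt : Tendsto (fun k : ℕ => q ^ k) atTop (𝓝 0) := tendsto_pow_atTop_nhds_zero_of_norm_lt_one hq
  refine Summable.of_nat_of_neg ?_ ?_
  · refine summable_of_ratio_tendsto (r := fun n => -q ^ n * Y) (L := 0) (by simp) ?_ fun n => ?_
    · simpa using hqt.neg.mul_const Y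
    · push_cast
      rw [qtri_succ h0, zpow_add_one₀ hY, zpow_natCast]
      ring
  · refine summable_of_ratio_tendsto (r := fun n => -q ^ n * (q / Y)) (L := 0) (by simp) ?_ fun n => ?_
    · simpa using hqt.neg.mul_const (q / Y)
    · push_cast
      rw [qtri_neg h0, qtri_neg h0, qtri_succ h0, zpow_neg, zpow_neg, zpow_add_one₀ hY,
        zpow_add_one₀ h0, zpow_natCast]
      field_simp

lemma summable_pow_div_qpinf {q a X : ℂ} (hq : ‖q‖ < 1) (h0 : q ≠ 0) (ha0 : a ≠ 0) (ha : ‖a‖ < 1)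
    (hX0 : X ≠ 0) (hX : ∀ m : ℤ, X ≠ q ^ m) :
    Summable fun n : ℤ => a ^ n / qpinf (X * q ^ n) q := by
  have hqt : Tendsto (fun k : ℕ => q ^ k) atTop (𝓝 0) := tendsto_pow_atTop_nhds_zero_of_norm_lt_one hq
  have hqt1 : Tendsto (fun k : ℕ => q ^ (k + 1)) atTop (𝓝 0) := (tendsto_add_atTop_iff_nat 1).2 hqt
  have hne := qpinf_zpow_ne_zero hq h0 hX
  refine Summable.of_nat_of_neg ?_ ?_
  · refine summable_of_ratio_tendsto (r := fun n => a * (1 - X * q ^ n)) ha ?_ fun n => ?_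
    · simpa using ((hqt.const_mul X).const_sub 1).const_mul a
    · have h1 := hne n
      rw [qpinf_zpow_succ hq h0, zpow_natCast] at h1
      push_cast
      rw [qpinf_zpow_succ hq h0 X n, zpow_add_one₀ ha0, zpow_natCast, zpow_natCast]
      have := left_ne_zero_of_mul h1
      have := right_ne_zero_of_mul h1
      field_simp
  · refine summable_of_ratio_tendsto (r := fun n => q ^ (n + 1) / (a * (q ^ (n + 1) - X))) (L := 0)
      (by simp) ?_ fun n => ?_
    · have := hqt1.div ((hqt1.sub_const X).const_mul a) (by simp [ha0, hX0])
      rwa [zero_div] at this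
    · have h1 := hne (-((n + 1 : ℕ) : ℤ))
      have hs : (-((n + 1 : ℕ) : ℤ)) + 1 = -(n : ℤ) := by push_cast; ring
      have h2 := hne (-(n : ℤ))
      have h3 : q ^ (n + 1) - X ≠ 0 := by
        have := hX (n + 1 : ℕ)
        rw [zpow_natCast] at this
        exact sub_ne_zero.2 this.symm
      have hq' : q ^ (n + 1) ≠ 0 := pow_ne_zero _ h0
      have h4 : 1 - X * (q ^ (n + 1))⁻¹ ≠ 0 := by
        rw [← div_eq_mul_inv, one_sub_div hq']
        exact div_ne_zero h3 hq'
      rw [qpinf_zpow_succ hq h0, hs, zpow_neg, zpow_neg, zpow_natCast, zpow_natCast]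
      have : 1 - X * (q ^ (n + 1))⁻¹ = (q ^ (n + 1) - X) / q ^ (n + 1) := by field_simp
      rw [this, zpow_neg, zpow_neg, zpow_natCast, zpow_natCast]
      rw [zpow_neg, zpow_natCast] at h2
      field_simp
      ring

/-- A transformation between a `₁ψ₂` and a `₂ψ₂` series. -/
theorem tsum_qtri_eq_tsum_pow {q a X Y : ℂ} (hq : ‖q‖ < 1) (h0 : q ≠ 0) (ha0 : a ≠ 0) (ha : ‖a‖ < 1)
    (hX0 : X ≠ 0) (hX : ∀ m : ℤ, X ≠ q ^ m) (hY0 : Y ≠ 0) (hY : ∀ m : ℤ, Y ≠ q ^ m) :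
    ∑' n : ℤ, qtri q n * (a * Y) ^ n * (qpinf (a * X * q ^ n) q / qpinf (X * q ^ n) q) =
      qpinf a q * qtheta q Y *
        ∑' n : ℤ, a ^ n / (qpinf (X * q ^ n) q * qpinf (Y * q ^ n) q) := by
  have hYne := qpinf_zpow_ne_zero hq h0 hY
  obtain ⟨C, hC⟩ := qpinv_bounded hq h0
  have hsum : Summable (Function.uncurry fun n m : ℤ =>
      a ^ n / qpinf (X * q ^ n) q * (qtri q m * Y ^ m) * qpinv q (n - m)) := by
    have h := ((summable_pow_div_qpinf hq h0 ha0 ha hX0 hX).norm.mul_of_nonneg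
      (summable_qtri hq h0 hY0).norm (fun _ => norm_nonneg _) (fun _ => norm_nonneg _)).mul_right C
    refine Summable.of_norm_bounded h fun p => ?_
    simp only [Function.uncurry]
    rw [norm_mul, norm_mul (_ / _)]
    gcongr
    exact hC _
  have hl : ∀ n : ℤ, a ^ n / (qpinf (X * q ^ n) q * qpinf (Y * q ^ n) q) * qtheta q Y =
      ∑' m : ℤ, a ^ n / qpinf (X * q ^ n) q * (qtri q m * Y ^ m) * qpinv q (n - m) := fun n => by
    simp only [mul_assoc (_ / _)]
    rw [tsum_mul_left, tsum_qtri_mul_qpinv_sub hq h0 hY0, ← qtheta_zpow hq h0 hY0 n]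
    have := hYne n
    generalize qpinf (Y * q ^ n) q = A at *
    ring_nf
    field_simp
  have hr : ∀ m : ℤ, qtri q m * (a * Y) ^ m * (qpinf (a * X * q ^ m) q / qpinf (X * q ^ m) q) =
      (∑' n : ℤ, a ^ n / qpinf (X * q ^ n) q * (qtri q m * Y ^ m) * qpinv q (n - m)) *
        qpinf a q := fun m => by
    have h := tsum_pow_mul_qpinv_sub hq h0 ha0 ha hX m
    rw [tsum_congr fun n => mul_right_comm _ (qtri q m * Y ^ m) (qpinv q (n - m)),
      tsum_mul_right, mul_right_comm (tsum _), h, mul_zpow]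
    ring
  rw [tsum_congr hr, tsum_mul_right, hsum.tsum_comm, ← tsum_congr hl, tsum_mul_right]
  ring

/-- A transformation between a `₁ψ₂` and a `₀ψ₂` series. -/
theorem qtheta_mul_tsum_qtri {q a x y : ℂ} (hq : ‖q‖ < 1) (h0 : q ≠ 0) (ha0 : a ≠ 0) (ha : ‖a‖ < 1)
    (hx0 : x ≠ 0) (hx : ∀ m : ℤ, x ≠ q ^ m) (hy0 : y ≠ 0) (hy : ∀ m : ℤ, y ≠ q ^ m)
    (hX : ∀ m : ℤ, x / a ≠ q ^ m) :
    qtheta q (x / a) *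
        ∑' n : ℤ, qtri q n * y ^ n * (qpinf (x * q ^ n) q / qpinf (x / a * q ^ n) q) =
      qpinf a q *
        ∑' n : ℤ, qtri q n ^ 2 * (x * y / a) ^ n * (qpinf (x * q ^ n) q * qpinf (y * q ^ n) q) := by
  have hinv : ∀ z : ℂ, z ≠ 0 → (∀ m : ℤ, z ≠ q ^ m) → ∀ m : ℤ, q / z ≠ q ^ m :=
    fun z hz0 hz m h => hz (1 - m) (by rw [zpow_sub₀ h0, ← h, zpow_one]; field_simp)
  have hx' := qpinf_zpow_ne_zero hq h0 (hinv x hx0 hx)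
  have hy' := qpinf_zpow_ne_zero hq h0 (hinv y hy0 hy)
  have hX' := qpinf_zpow_ne_zero hq h0 hX
  have hθx := qtheta_ne_zero hq h0 hx0 hx
  have key := tsum_qtri_eq_tsum_pow hq h0 ha0 ha (div_ne_zero h0 hx0) (hinv x hx0 hx)
    (div_ne_zero h0 hy0) (hinv y hy0 hy)
  have hθy : qtheta q (q / y) = qtheta q y := by
    rw [qtheta, qtheta, div_div_cancel₀ h0, mul_comm]
  have e1 : ∑' n : ℤ, qtri q n ^ 2 * (x * y / a) ^ n * (qpinf (x * q ^ n) q * qpinf (y * q ^ n) q) =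
      qtheta q x * qtheta q y *
        ∑' n : ℤ, a ^ n / (qpinf (q / x * q ^ n) q * qpinf (q / y * q ^ n) q) := by
    rw [← (Equiv.neg ℤ).tsum_eq fun n : ℤ => a ^ n / (qpinf (q / x * q ^ n) q * qpinf (q / y * q ^ n) q),
      ← tsum_mul_left]
    refine tsum_congr fun n => ?_
    simp only [Equiv.neg_apply]
    rw [← qtheta_zpow hq h0 hx0 n, ← qtheta_zpow hq h0 hy0 n, zpow_neg a, div_zpow, mul_zpow]
    have h1 := hx' (-n)
    have h2 := hy' (-n)
    generalize qpinf (q / x * q ^ (-n)) q = A at *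
    generalize qpinf (q / y * q ^ (-n)) q = B at *
    field_simp
  have e2 : qtheta q x * ∑' n : ℤ, qtri q n * (a * (q / y)) ^ n *
        (qpinf (a * (q / x) * q ^ n) q / qpinf (q / x * q ^ n) q) =
      qtheta q (x / a) *
        ∑' n : ℤ, qtri q n * y ^ n * (qpinf (x * q ^ n) q / qpinf (x / a * q ^ n) q) := by
    rw [← (Equiv.neg ℤ).tsum_eq, ← tsum_mul_left, ← tsum_mul_left]
    refine tsum_congr fun n => ?_
    simp only [Equiv.neg_apply]
    rw [← qtheta_zpow hq h0 hx0 n, ← qtheta_zpow hq h0 (div_ne_zero hx0 ha0) n, qtri_neg h0,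
      show q / (x / a) = a * (q / x) by field_simp, zpow_neg (a * (q / y)), div_zpow, mul_zpow, div_zpow]
    have h1 := hx' (-n)
    have h2 := hX' n
    have h3 := zpow_ne_zero n h0
    generalize qpinf (q / x * q ^ (-n)) q = A at *
    generalize qpinf (x / a * q ^ n) q = B at *
    field_simp
  rw [← e2, key, e1, hθy]
  ring

lemma e_ne_zero (z : ℂ) : e z ≠ 0 := Complex.exp_ne_zero _

lemma e_add (z w : ℂ) : e (z + w) = e z * e w := by
  rw [e, e, e, ← Complex.exp_add, mul_add]

lemma e_neg (z : ℂ) : e (-z) = (e z)⁻¹ := by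
  rw [e, e, ← Complex.exp_neg, mul_neg]

lemma e_int_mul (n : ℤ) (z : ℂ) : e (n * z) = e z ^ n := by
  rw [e, e, ← Complex.exp_int_mul]
  congr 1
  ring

lemma norm_e_lt_one {z : ℂ} (hz : 0 < z.im) : ‖e z‖ < 1 := by
  rw [e, Complex.norm_exp, Real.exp_lt_one_iff]
  simp [Complex.mul_re, Complex.mul_im]
  positivity

/-- The generalized μ-function as a `₁ψ₂` series in multiplicative notation. -/
lemma genMu_eq (τ u v α : ℂ) :
    genMu τ u v α =
      -Complex.I * e (-τ / 8) * e (α * (u - v) / 2) /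
        (qpinf (e τ) (e τ) * qtheta (e τ) (e v)) *
        ∑' n : ℤ, qtri (e τ) n * e v ^ n *
          (qpinf (e u * e τ ^ n) (e τ) / qpinf (e u / e (α * τ) * e τ ^ n) (e τ)) := by
  have hterm : ∀ n : ℤ, (-1 : ℂ) ^ n * e (((n : ℂ) + 1 / 2) * v) * (e τ) ^ ((n * (n + 1)) / 2) *
      (qpinf (e u * (e τ) ^ (n + 1)) (e τ) / qpinf (e u * e (τ * ((n : ℂ) - α + 1))) (e τ)) =
      -e (-v / 2) * (qtri (e τ) (n + 1) * e v ^ (n + 1) *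
        (qpinf (e u * e τ ^ (n + 1)) (e τ) /
          qpinf (e u / e (α * τ) * e τ ^ (n + 1)) (e τ))) := fun n => by
    have h1 : e (((n : ℂ) + 1 / 2) * v) = e v ^ (n + 1) * e (-v / 2) := by
      rw [← e_int_mul, ← e_add]
      congr 1
      push_cast
      ring
    have h2 : e u * e (τ * ((n : ℂ) - α + 1)) = e u / e (α * τ) * e τ ^ (n + 1) := by
      have harg : τ * ((n : ℂ) - α + 1) = -(α * τ) + ((n + 1 : ℤ) : ℂ) * τ := by
        push_cast
        ring
      rw [harg, e_add, e_neg, e_int_mul, div_eq_mul_inv, mul_assoc]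
    rw [h1, h2, qtri, zpow_add_one₀ (by norm_num : (-1 : ℂ) ≠ 0), add_sub_cancel_right,
      mul_comm (n + 1) n]
    ring
  have hshift := (Equiv.addRight (1 : ℤ)).tsum_eq fun n : ℤ => qtri (e τ) n * e v ^ n *
    (qpinf (e u * e τ ^ n) (e τ) / qpinf (e u / e (α * τ) * e τ ^ n) (e τ))
  simp only [Equiv.coe_addRight] at hshift
  rw [genMu, tsum_congr hterm, tsum_mul_left, hshift, theta11, neg_div 8 τ, e_neg (τ / 8), ← mul_assoc]
  congr 1
  have h1 := e_ne_zero (-v / 2)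
  have h2 := e_ne_zero (τ / 8)
  have h3 : Complex.I ^ 2 = -1 := Complex.I_sq
  have h4 := Complex.I_ne_zero
  rw [show -Complex.I * e (τ / 8) * e (-v / 2) * qpinf (e τ) (e τ) * qtheta (e τ) (e v) =
    (-Complex.I * e (τ / 8) * e (-v / 2)) * (qpinf (e τ) (e τ) * qtheta (e τ) (e v)) by ring,
    ← div_div, div_mul_eq_mul_div]
  congr 1
  generalize e (-v / 2) = A at *
  field_simp
  linear_combination e (α * (u - v) / 2) * h3

theorem stmt13 (τ u v α : ℂ) (hτ : 0 < τ.im)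
    (hu : ∀ m n : ℤ, u ≠ (m : ℂ) + (n : ℂ) * τ)
    (hv : ∀ m n : ℤ, v ≠ (m : ℂ) + (n : ℂ) * τ)
    (hα : 0 < (α * τ).im)
    (q x y a : ℂ)
    (hq : q = e τ) (hx : x = e u) (hy : y = e v) (ha : a = e (α * τ))
    (h1 : ∀ m : ℤ, x ≠ q ^ m) (h2 : ∀ m : ℤ, y ≠ q ^ m)
    (h3 : ∀ m : ℤ, x / a ≠ q ^ m) (h4 : ∀ m : ℤ, y / a ≠ q ^ m) :
    genMu τ u v α =
      - Complex.I * e (-τ / 8) * e (α * (u - v) / 2) *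
        (1 / (qpinf q q * qtheta q (x / a))) * (qpinf (a * q / y) q / qpinf (q / y) q) *
        (∑' n : ℤ, qpint (y / a) q n / (qpint 0 q n * qpint y q n) *
          ((-1 : ℂ) ^ n * q ^ ((n * (n - 1)) / 2)) * x ^ n) ∧
    genMu τ u v α =
      - Complex.I * e (-τ / 8) * e (α * (u - v) / 2) *
        (qpinf a q * qpinf (a * q / x) q * qpinf (a * q / y) q /
          (qpinf q q * qtheta q y * qtheta q (x / a))) *
        (∑' n : ℤ, qpint (x / a) q n * qpint (y / a) q n /
          (qpint 0 q n * qpint 0 q n) * a ^ n) ∧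
    genMu τ u v α =
      - Complex.I * e (-τ / 8) * e (α * (u - v) / 2) *
        (qpinf a q * qpinf x q * qpinf y q /
          (qpinf q q * qtheta q y * qtheta q (x / a))) *
        (∑' n : ℤ, (1 / (qpint x q n * qpint y q n)) *
          ((-1 : ℂ) ^ n * q ^ ((n * (n - 1)) / 2)) ^ 2 * (x * y / a) ^ n) := by
  have hq1 : ‖q‖ < 1 := hq ▸ norm_e_lt_one hτ
  have ha1 : ‖a‖ < 1 := ha ▸ norm_e_lt_one hα
  have hq0 : q ≠ 0 := hq ▸ e_ne_zero _
  have hx0 : x ≠ 0 := hx ▸ e_ne_zero _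
  have hy0 : y ≠ 0 := hy ▸ e_ne_zero _
  have ha0 : a ≠ 0 := ha ▸ e_ne_zero _
  have hX0 := div_ne_zero hx0 ha0
  have hY0 := div_ne_zero hy0 ha0
  have hxn := qpinf_zpow_ne_zero hq1 hq0 h1
  have hyn := qpinf_zpow_ne_zero hq1 hq0 h2
  have hXn := qpinf_zpow_ne_zero hq1 hq0 h3
  have hYn := qpinf_zpow_ne_zero hq1 hq0 h4
  have hθX := qtheta_ne_zero hq1 hq0 hX0 h3
  have hθy := qtheta_ne_zero hq1 hq0 hy0 h2
  have hqq := qpinf_self_ne_zero hq1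
  have hx' : qpinf x q ≠ 0 := by simpa using hxn 0
  have hy' : qpinf y q ≠ 0 := by simpa using hyn 0
  have hqy : qpinf (q / y) q ≠ 0 := right_ne_zero_of_mul hθy
  have hX1 : a * q / x = q / (x / a) := by field_simp
  have hY1 : a * q / y = q / (y / a) := by field_simp
  have hμ := genMu_eq τ u v α
  rw [← hq, ← hx, ← hy, ← ha] at hμ
  have hA := tsum_qtri_eq_tsum_pow hq1 hq0 ha0 ha1 hX0 h3 hY0 h4
  have hB := tsum_qtri_eq_tsum_pow hq1 hq0 ha0 ha1 hY0 h4 hX0 h3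
  have hC := qtheta_mul_tsum_qtri hq1 hq0 ha0 ha1 hx0 h1 hy0 h2 h3
  have hswap : ∑' n : ℤ, a ^ n / (qpinf (y / a * q ^ n) q * qpinf (x / a * q ^ n) q) =
      ∑' n : ℤ, a ^ n / (qpinf (x / a * q ^ n) q * qpinf (y / a * q ^ n) q) :=
    tsum_congr fun n => by rw [mul_comm (qpinf _ q)]
  rw [hswap] at hB
  simp only [mul_div_cancel₀ _ ha0] at hA hB
  have hq0int : ∀ n : ℤ, qpint 0 q n = 1 := fun n => by simp [qpint, qpinf_zero]
  have s1 : ∑' n : ℤ, qpint (y / a) q n / (qpint 0 q n * qpint y q n) *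
      ((-1 : ℂ) ^ n * q ^ ((n * (n - 1)) / 2)) * x ^ n =
      qpinf (y / a) q / qpinf y q *
        ∑' n : ℤ, qtri q n * x ^ n * (qpinf (y * q ^ n) q / qpinf (y / a * q ^ n) q) := by
    rw [← tsum_mul_left]
    refine tsum_congr fun n => ?_
    rw [hq0int, qpint, qpint, ← qtri]
    have := hyn n
    have := hYn n
    generalize qpinf (y / a * q ^ n) q = B at *
    field_simp
  have s2 : ∑' n : ℤ, qpint (x / a) q n * qpint (y / a) q n /
      (qpint 0 q n * qpint 0 q n) * a ^ n =
      qpinf (x / a) q * qpinf (y / a) q *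
        ∑' n : ℤ, a ^ n / (qpinf (x / a * q ^ n) q * qpinf (y / a * q ^ n) q) := by
    rw [← tsum_mul_left]
    refine tsum_congr fun n => ?_
    rw [hq0int, qpint, qpint]
    ring
  have s3 : ∑' n : ℤ, (1 / (qpint x q n * qpint y q n)) *
      ((-1 : ℂ) ^ n * q ^ ((n * (n - 1)) / 2)) ^ 2 * (x * y / a) ^ n =
      1 / (qpinf x q * qpinf y q) * ∑' n : ℤ, qtri q n ^ 2 * (x * y / a) ^ n *
        (qpinf (x * q ^ n) q * qpinf (y * q ^ n) q) := by
    rw [← tsum_mul_left]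
    refine tsum_congr fun n => ?_
    rw [qpint, qpint, ← qtri, div_mul_div_comm, one_div_div]
    ring
  rw [s1, s2, s3, hμ, hX1, hY1]
  have hθX' : qtheta q (x / a) = qpinf (x / a) q * qpinf (q / (x / a)) q := rfl
  have hθY' : qtheta q (y / a) = qpinf (y / a) q * qpinf (q / (y / a)) q := rfl
  have hθy' : qtheta q y = qpinf y q * qpinf (q / y) q := rfl
  refine ⟨?_, ?_, ?_⟩
  · rw [hA, hB, hθY', hθy']
    generalize qpinf (q / (y / a)) q = Y' at *
    generalize qpinf (y / a) q = Y at *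
    field_simp
  · rw [hA, hθY']
    rw [hθX'] at hθX ⊢
    have h5 := left_ne_zero_of_mul hθX
    have h6 := right_ne_zero_of_mul hθX
    generalize qpinf (q / (y / a)) q = Y' at *
    generalize qpinf (y / a) q = Y at *
    generalize qpinf (q / (x / a)) q = X' at *
    generalize qpinf (x / a) q = X at *
    generalize ∑' n : ℤ, a ^ n / (qpinf (x / a * q ^ n) q * qpinf (y / a * q ^ n) q) = S
    field_simp
  · rw [eq_div_of_mul_eq hθX ((mul_comm _ _).trans hC)]
    generalize qtheta q (x / a) = X at *
    field_simp
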